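/- Let A₁ and A₂ be complex Banach algebras and let A₁ ⊕ A₂ denote their direct sum, the Banach algebra on the Cartesian product with coordinatewise operations and norm ‖(a₁,a₂)‖ = ‖a₁‖ + ‖a₂‖. Then A₁ ⊕ A₂ is cyclically weakly amenable if and only if both A₁ and A₂ are cyclically weakly amenable. -/

import Mathlib

/-- `D : A → A*` (a continuous linear map into the dual) is a *derivation* when
`D(ab) = D(a)·b + a·D(b)`, where `A*` is an `A`-bimodule via `(F·a)(x) = F(ax)` and
`(a·F)(x) = F(xa)`; pairing against `x : A` gives the condition below. -/
def IsDerivation {A : Type*} [NonUnitalNormedRing A] [NormedSpace ℂ A]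
    (D : A →L[ℂ] (A →L[ℂ] ℂ)) : Prop :=
  ∀ a b x : A, D (a * b) x = D a (b * x) + D b (x * a)

/-- A map `D : A → A*` is *cyclic* when `⟨D(a), b⟩ + ⟨D(b), a⟩ = 0` for all `a, b`. -/
def IsCyclicMap {A : Type*} [NonUnitalNormedRing A] [NormedSpace ℂ A]
    (D : A →L[ℂ] (A →L[ℂ] ℂ)) : Prop :=
  ∀ a b : A, D a b + D b a = 0

/-- `D : A → A*` is *inner* if `D = ad_F` for some `F ∈ A*`, where
`ad_F(a) = F·a - a·F`, i.e. `⟨ad_F(a), x⟩ = F(ax) - F(xa)`. -/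
def IsInnerDerivation {A : Type*} [NonUnitalNormedRing A] [NormedSpace ℂ A]
    (D : A →L[ℂ] (A →L[ℂ] ℂ)) : Prop :=
  ∃ F : A →L[ℂ] ℂ, ∀ a x : A, D a x = F (a * x) - F (x * a)

/-- A Banach algebra `A` is *cyclically weakly amenable* if every continuous derivation
from `A` into `A*` is cyclic. -/
def CyclicallyWeaklyAmenable (A : Type*) [NonUnitalNormedRing A] [NormedSpace ℂ A] : Prop :=
  ∀ D : A →L[ℂ] (A →L[ℂ] ℂ), IsDerivation D → IsCyclicMap D

/-- A Banach algebra `A` is *weakly amenable* if every continuous derivation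
from `A` into `A*` is inner. -/
def WeaklyAmenable (A : Type*) [NonUnitalNormedRing A] [NormedSpace ℂ A] : Prop :=
  ∀ D : A →L[ℂ] (A →L[ℂ] ℂ), IsDerivation D → IsInnerDerivation D

/-- A Banach algebra `A` is *cyclically amenable* if every continuous cyclic derivation
from `A` into `A*` is inner. -/
def CyclicallyAmenable (A : Type*) [NonUnitalNormedRing A] [NormedSpace ℂ A] : Prop :=
  ∀ D : A →L[ℂ] (A →L[ℂ] ℂ), IsDerivation D → IsCyclicMap D → IsInnerDerivation D

namespace L1Prod

variable {α β : Type*} [NonUnitalNormedRing α] [NonUnitalNormedRing β]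

noncomputable instance : NonUnitalRing (WithLp 1 (α × β)) :=
  (WithLp.equiv 1 (α × β)).nonUnitalRing

lemma norm_def (x : WithLp 1 (α × β)) : ‖x‖ = ‖x.fst‖ + ‖x.snd‖ := by
  rw [WithLp.prod_norm_eq_add (by norm_num)]
  norm_num

lemma mul_fst (x y : WithLp 1 (α × β)) : (x * y).fst = x.fst * y.fst := rfl
lemma mul_snd (x y : WithLp 1 (α × β)) : (x * y).snd = x.snd * y.snd := rfl

/-- The direct sum `A₁ ⊕ A₂` of two (non-unital) normed rings, i.e. the Cartesian product
with coordinatewise operations and the norm `‖(a₁, a₂)‖ = ‖a₁‖ + ‖a₂‖`, as a normed ring. -/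
noncomputable instance : NonUnitalNormedRing (WithLp 1 (α × β)) :=
  { (inferInstance : NormedAddCommGroup (WithLp 1 (α × β))),
    (inferInstance : NonUnitalRing (WithLp 1 (α × β))) with
    dist_eq := NormedAddCommGroup.dist_eq
    norm_mul_le := fun x y => by
      simp only [norm_def, mul_fst, mul_snd]
      have h1 : ‖x.fst * y.fst‖ + ‖x.snd * y.snd‖ ≤ ‖x.fst‖ * ‖y.fst‖ + ‖x.snd‖ * ‖y.snd‖ :=
        add_le_add (norm_mul_le _ _) (norm_mul_le _ _)
      refine h1.trans ?_
      nlinarith [norm_nonneg x.fst, norm_nonneg x.snd, norm_nonneg y.fst, norm_nonneg y.snd] }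

variable [NormedSpace ℂ α] [NormedSpace ℂ β]
  [IsScalarTower ℂ α α] [SMulCommClass ℂ α α] [IsScalarTower ℂ β β] [SMulCommClass ℂ β β]

noncomputable instance : IsScalarTower ℂ (WithLp 1 (α × β)) (WithLp 1 (α × β)) :=
  ⟨fun c x y => congrArg (WithLp.toLp 1) (smul_assoc c x.ofLp y.ofLp)⟩

noncomputable instance : SMulCommClass ℂ (WithLp 1 (α × β)) (WithLp 1 (α × β)) :=
  ⟨fun c x y => congrArg (WithLp.toLp 1) (smul_comm c x.ofLp y.ofLp)⟩

end L1Prod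

section Pullback

variable {A B : Type*} [NonUnitalNormedRing A] [NormedSpace ℂ A]
  [NonUnitalNormedRing B] [NormedSpace ℂ B]

/-- Derivations into the dual pull back along multiplicative maps. -/
lemma IsDerivation.bilinearComp {D : B →L[ℂ] (B →L[ℂ] ℂ)} (hD : IsDerivation D)
    (φ : A →L[ℂ] B) (hφ : ∀ x y, φ (x * y) = φ x * φ y) :
    IsDerivation (D.bilinearComp φ φ) := fun a b x => by
  simpa [hφ] using hD (φ a) (φ b) (φ x)

lemma CyclicallyWeaklyAmenable.of_surjective (hA : CyclicallyWeaklyAmenable A)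
    (φ : A →L[ℂ] B) (hφ : ∀ x y, φ (x * y) = φ x * φ y) (hs : Function.Surjective φ) :
    CyclicallyWeaklyAmenable B := fun D hD a b => by
  obtain ⟨a, rfl⟩ := hs a
  obtain ⟨b, rfl⟩ := hs b
  exact hA _ (hD.bilinearComp φ hφ) a b

/-- A functional vanishing on all products in a cyclically weakly amenable algebra is zero. -/
lemma CyclicallyWeaklyAmenable.eq_zero_of_mul (hA : CyclicallyWeaklyAmenable A)
    (F : A →L[ℂ] ℂ) (hF : ∀ x y, F (x * y) = 0) (a : A) : F a = 0 := by
  have h := hA (F.smulRight F) (fun a b x => by simp [hF]) a a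
  simpa using h

end Pullback

namespace L1Prod

variable (α β : Type*) [NonUnitalNormedRing α] [NonUnitalNormedRing β]
  [NormedSpace ℂ α] [NormedSpace ℂ β]

/-- The first projection of the direct sum. -/
noncomputable def fstCLM : WithLp 1 (α × β) →L[ℂ] α :=
  (ContinuousLinearMap.fst ℂ α β).comp
    (WithLp.prodContinuousLinearEquiv 1 ℂ α β : WithLp 1 (α × β) →L[ℂ] α × β)

/-- The second projection of the direct sum. -/
noncomputable def sndCLM : WithLp 1 (α × β) →L[ℂ] β :=
  (ContinuousLinearMap.snd ℂ α β).comp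
    (WithLp.prodContinuousLinearEquiv 1 ℂ α β : WithLp 1 (α × β) →L[ℂ] α × β)

/-- The first inclusion into the direct sum. -/
noncomputable def inlCLM : α →L[ℂ] WithLp 1 (α × β) :=
  ((WithLp.prodContinuousLinearEquiv 1 ℂ α β).symm : α × β →L[ℂ] WithLp 1 (α × β)).comp
    (ContinuousLinearMap.inl ℂ α β)

/-- The second inclusion into the direct sum. -/
noncomputable def inrCLM : β →L[ℂ] WithLp 1 (α × β) :=
  ((WithLp.prodContinuousLinearEquiv 1 ℂ α β).symm : α × β →L[ℂ] WithLp 1 (α × β)).comp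
    (ContinuousLinearMap.inr ℂ α β)

variable {α β}

lemma inlCLM_mul (x y : α) : inlCLM α β (x * y) = inlCLM α β x * inlCLM α β y :=
  congrArg (WithLp.toLp 1) (Prod.ext rfl (mul_zero (0 : β)).symm)

lemma inrCLM_mul (x y : β) : inrCLM α β (x * y) = inrCLM α β x * inrCLM α β y :=
  congrArg (WithLp.toLp 1) (Prod.ext (mul_zero (0 : α)).symm rfl)

lemma inlCLM_mul_inrCLM (x : α) (y : β) : inlCLM α β x * inrCLM α β y = 0 :=
  congrArg (WithLp.toLp 1) (Prod.ext (mul_zero x) (zero_mul y))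

lemma inrCLM_mul_inlCLM (x : α) (y : β) : inrCLM α β y * inlCLM α β x = 0 :=
  congrArg (WithLp.toLp 1) (Prod.ext (zero_mul x) (mul_zero y))

lemma inlCLM_fst_add_inrCLM_snd (x : WithLp 1 (α × β)) :
    inlCLM α β x.fst + inrCLM α β x.snd = x :=
  congrArg (WithLp.toLp 1) (Prod.ext (add_zero x.fst) (zero_add x.snd))

end L1Prod

open L1Prod

/-- The direct sum `A₁ ⊕ A₂` (with norm `‖(a₁,a₂)‖ = ‖a₁‖ + ‖a₂‖`) of two complex Banach
algebras is cyclically weakly amenable iff both `A₁` and `A₂` are. -/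
theorem cyclicallyWeaklyAmenable_directSum_iff {A₁ A₂ : Type*}
    [NonUnitalNormedRing A₁] [NormedSpace ℂ A₁] [IsScalarTower ℂ A₁ A₁]
    [SMulCommClass ℂ A₁ A₁] [CompleteSpace A₁]
    [NonUnitalNormedRing A₂] [NormedSpace ℂ A₂] [IsScalarTower ℂ A₂ A₂]
    [SMulCommClass ℂ A₂ A₂] [CompleteSpace A₂] :
    CyclicallyWeaklyAmenable (WithLp 1 (A₁ × A₂)) ↔
      CyclicallyWeaklyAmenable A₁ ∧ CyclicallyWeaklyAmenable A₂ := by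
  refine ⟨fun h => ⟨h.of_surjective (fstCLM A₁ A₂) (fun _ _ => rfl)
      fun a => ⟨inlCLM A₁ A₂ a, rfl⟩, h.of_surjective (sndCLM A₁ A₂) (fun _ _ => rfl)
      fun a => ⟨inrCLM A₁ A₂ a, rfl⟩⟩, ?_⟩
  rintro ⟨h₁, h₂⟩ D hD x y
  have hlr (a : A₁) (b : A₂) : D (inlCLM A₁ A₂ a) (inrCLM A₁ A₂ b) = 0 :=
    h₁.eq_zero_of_mul ((D.flip (inrCLM A₁ A₂ b)).comp (inlCLM A₁ A₂))
      (fun u v => by simp [inlCLM_mul, hD _ _ _, inlCLM_mul_inrCLM, inrCLM_mul_inlCLM]) a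
  have hrl (a : A₁) (b : A₂) : D (inrCLM A₁ A₂ b) (inlCLM A₁ A₂ a) = 0 :=
    h₂.eq_zero_of_mul ((D.flip (inlCLM A₁ A₂ a)).comp (inrCLM A₁ A₂))
      (fun u v => by simp [inrCLM_mul, hD _ _ _, inlCLM_mul_inrCLM, inrCLM_mul_inlCLM]) b
  have hl : D (inlCLM A₁ A₂ x.fst) (inlCLM A₁ A₂ y.fst) +
      D (inlCLM A₁ A₂ y.fst) (inlCLM A₁ A₂ x.fst) = 0 :=
    h₁ _ (hD.bilinearComp (inlCLM A₁ A₂) inlCLM_mul) x.fst y.fst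
  have hr : D (inrCLM A₁ A₂ x.snd) (inrCLM A₁ A₂ y.snd) +
      D (inrCLM A₁ A₂ y.snd) (inrCLM A₁ A₂ x.snd) = 0 :=
    h₂ _ (hD.bilinearComp (inrCLM A₁ A₂) inrCLM_mul) x.snd y.snd
  rw [← inlCLM_fst_add_inrCLM_snd x, ← inlCLM_fst_add_inrCLM_snd y]
  simp only [map_add, add_apply, hlr, hrl]
  linear_combination hl + hr
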